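/- Let P̃ : ℝⁿ → ℝ be differentiable, Q̃ : ℝⁿ → ℝ^{n×n} with Q̃(x) invertible and vᵀQ̃(x)v ≤ 0 for all x ∈ ℝⁿ and v ∈ ℝⁿ, and g ∈ ℝ^{n×m} a constant matrix. Let x : ℝ → ℝⁿ be differentiable and u : ℝ → ℝᵐ be such that ẋ(t) = Q̃(x(t))^{-1} ∇P̃(x(t)) + g u(t) for all t. Define y(t) := −gᵀ Q̃(x(t))ᵀ ẋ(t). Then for all t, (d/dt) P̃(x(t)) ≤ ⟨y(t), u(t)⟩. -/

import Mathlib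

open RealInnerProductSpace Matrix

/-- The transpose of a real matrix is its adjoint for the Euclidean inner product. -/
theorem inner_toEuclideanLin_transpose {m n : ℕ} (A : Matrix (Fin m) (Fin n) ℝ)
    (v : EuclideanSpace ℝ (Fin m)) (w : EuclideanSpace ℝ (Fin n)) :
    ⟪toEuclideanLin Aᵀ v, w⟫ = ⟪v, toEuclideanLin A w⟫ := by
  rw [← conjTranspose_eq_transpose_of_trivial, toEuclideanLin_conjTranspose_eq_adjoint,
    LinearMap.adjoint_inner_left]

/-- Passivity of Brayton–Moser systems: if `Q̃(x)` is invertible with `vᵀQ̃(x)v ≤ 0`, then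
along trajectories of `ẋ = Q̃(x)⁻¹∇P̃(x) + gu`, with `y = −gᵀQ̃(x)ᵀẋ`, one has
`(d/dt)P̃(x(t)) ≤ ⟨y(t), u(t)⟩`. -/
theorem stmt_17 {n m : ℕ}
    (Pt : EuclideanSpace ℝ (Fin n) → ℝ) (hPt : Differentiable ℝ Pt)
    (Qt : EuclideanSpace ℝ (Fin n) → Matrix (Fin n) (Fin n) ℝ)
    (hQtInv : ∀ x, IsUnit (Qt x))
    (hQtNeg : ∀ (x : EuclideanSpace ℝ (Fin n)) (v : EuclideanSpace ℝ (Fin n)),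
      ⟪v, Matrix.toEuclideanLin (Qt x) v⟫ ≤ 0)
    (g : Matrix (Fin n) (Fin m) ℝ)
    (x : ℝ → EuclideanSpace ℝ (Fin n)) (hx : Differentiable ℝ x)
    (u : ℝ → EuclideanSpace ℝ (Fin m))
    (hdyn : ∀ t, deriv x t
        = Matrix.toEuclideanLin (Qt (x t))⁻¹ (gradient Pt (x t))
          + Matrix.toEuclideanLin g (u t))
    (y : ℝ → EuclideanSpace ℝ (Fin m))
    (hy : ∀ t, y t = -Matrix.toEuclideanLin gᵀ (Matrix.toEuclideanLin (Qt (x t))ᵀ (deriv x t))) :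
    ∀ t, deriv (fun s => Pt (x s)) t ≤ ⟪y t, u t⟫ := by
  intro t
  have hderiv : deriv (fun s => Pt (x s)) t = ⟪gradient Pt (x t), deriv x t⟫ := by
    have h := (hPt (x t)).hasGradientAt.hasFDerivAt.comp_hasDerivAt t (hx t).hasDerivAt
    simpa [Function.comp_def] using h.deriv
  have hgrad : gradient Pt (x t) = toEuclideanLin (Qt (x t)) (deriv x t)
      - toEuclideanLin (Qt (x t)) (toEuclideanLin g (u t)) := by
    have hcancel : toEuclideanLin (Qt (x t)) (toEuclideanLin (Qt (x t))⁻¹ (gradient Pt (x t)))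
        = gradient Pt (x t) := by
      have hdet := (Matrix.isUnit_iff_isUnit_det _).mp (hQtInv (x t))
      simp [toLpLin_apply, mulVec_mulVec, Matrix.mul_nonsing_inv _ hdet]
    rw [hdyn t, map_add, hcancel, add_sub_cancel_right]
  have hout : ⟪y t, u t⟫
      = -⟪deriv x t, toEuclideanLin (Qt (x t)) (toEuclideanLin g (u t))⟫ := by
    rw [hy t, inner_neg_left, inner_toEuclideanLin_transpose, inner_toEuclideanLin_transpose]
  rw [hderiv, hout, real_inner_comm, hgrad, inner_sub_right]
  linarith [hQtNeg (x t) (deriv x t)]
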